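/- Let Λ be a finitely aligned k-graph, let 𝓔 ⊆ FE(Λ) be satiated, and let {t_λ : λ ∈ Λ} be a relative Cuntz-Krieger (Λ;𝓔)-family in a C*-algebra such that t_v ≠ 0 for every vertex v, and ∏_{λ∈F}(t_{r(F)} − t_λt_λ*) ≠ 0 for every F ∈ FE(Λ) \ 𝓔. Then for every vertex v and every finite subset E ⊆ vΛ \ Λ⁰, ∏_{λ∈E}(t_v − t_λt_λ*) = 0 if and only if E ∈ 𝓔. -/

import Mathlib

open scoped ENNReal

attribute [local instance] Classical.propDecidable

/-- Product of `f` over a set `S`, in some arbitrary order (junk value `1` if `S` is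
infinite).  Used for products of commuting projections. -/
noncomputable def listProd {ι A : Type*} [Monoid A] (S : Set ι) (f : ι → A) : A :=
  if h : S.Finite then (h.toFinset.toList.map f).prod else 1

/-- A `k`-graph: a countable category `Λ` (whose morphisms are the terms of `Path`, with
vertices identified with the morphisms of degree `0`) together with a degree functor
`d : Λ → ℕ^k` satisfying the factorisation property. -/
structure KGraph (k : ℕ) where
  Path : Type
  countable : Countable Path
  d : Path → Fin k → ℕ
  r : Path → Path
  s : Path → Path
  comp : Path → Path → Path
  d_r : ∀ lam, d (r lam) = 0
  d_s : ∀ lam, d (s lam) = 0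
  r_r : ∀ lam, r (r lam) = r lam
  s_r : ∀ lam, s (r lam) = r lam
  r_s : ∀ lam, r (s lam) = s lam
  s_s : ∀ lam, s (s lam) = s lam
  comp_source : ∀ lam, comp lam (s lam) = lam
  range_comp : ∀ lam, comp (r lam) lam = lam
  r_comp : ∀ lam mu, s lam = r mu → r (comp lam mu) = r lam
  s_comp : ∀ lam mu, s lam = r mu → s (comp lam mu) = s mu
  d_comp : ∀ lam mu, s lam = r mu → d (comp lam mu) = d lam + d mu
  comp_assoc : ∀ lam mu nu, s lam = r mu → s mu = r nu →
    comp (comp lam mu) nu = comp lam (comp mu nu)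
  factor : ∀ lam m n, d lam = m + n →
    ∃! p : Path × Path, s p.1 = r p.2 ∧ d p.1 = m ∧ d p.2 = n ∧ comp p.1 p.2 = lam

namespace KGraph

variable {k : ℕ} (Λ : KGraph k)

/-- Vertices are identified with the paths of degree `0`. -/
def IsVertex (v : Λ.Path) : Prop := Λ.d v = 0

/-- The unique factorisation of `lam` as a product of a path of degree `m` and the
remaining tail (junk value if `¬ m ≤ d lam`). -/
noncomputable def split (lam : Λ.Path) (m : Fin k → ℕ) : Λ.Path × Λ.Path :=
  if h : m ≤ Λ.d lam then
    (Λ.factor lam m (Λ.d lam - m) (by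
      funext i
      exact (Nat.add_sub_cancel' (h i)).symm)).choose
  else (lam, lam)

/-- The segment `λ(m,n)` of the path `λ`: the unique path of degree `n - m` such that
`λ = λ(0,m) λ(m,n) λ(n, d λ)` (meaningful for `m ≤ n ≤ d λ`). -/
noncomputable def seg (lam : Λ.Path) (m n : Fin k → ℕ) : Λ.Path :=
  (Λ.split (Λ.split lam n).1 m).2

/-- `MCE(μ,ν)`: minimal common extensions of `μ` and `ν`. -/
def MCE (mu nu : Λ.Path) : Set Λ.Path :=
  {lam | Λ.d lam = Λ.d mu ⊔ Λ.d nu ∧ Λ.seg lam 0 (Λ.d mu) = mu ∧ Λ.seg lam 0 (Λ.d nu) = nu}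

/-- `Λ^min(μ,ν) = {(α,β) : μα = νβ ∈ MCE(μ,ν)}`. -/
def Lmin (mu nu : Λ.Path) : Set (Λ.Path × Λ.Path) :=
  {p | Λ.s mu = Λ.r p.1 ∧ Λ.s nu = Λ.r p.2 ∧ Λ.comp mu p.1 = Λ.comp nu p.2 ∧
    Λ.comp mu p.1 ∈ Λ.MCE mu nu}

/-- `Ext(μ;E)`: extensions of `μ` with respect to `E`. -/
def Ext (mu : Λ.Path) (E : Set Λ.Path) : Set Λ.Path :=
  {a | Λ.r a = Λ.s mu ∧ ∃ nu ∈ E, ∃ b, (a, b) ∈ Λ.Lmin mu nu}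

/-- `Λ` is finitely aligned if all the sets `MCE(μ,ν)` are finite. -/
def FinitelyAligned : Prop := ∀ mu nu, (Λ.MCE mu nu).Finite

/-- `E ⊆ vΛ` is exhaustive if `Ext(λ;E) ≠ ∅` for all `λ ∈ vΛ`. -/
def Exhaustive (v : Λ.Path) (E : Set Λ.Path) : Prop :=
  ∀ lam, Λ.r lam = v → (Λ.Ext lam E).Nonempty

/-- `E ∈ vFE(Λ)`: `E ⊆ vΛ \ {v}` is finite and exhaustive (so `r(E) = v`). -/
def FEat (v : Λ.Path) (E : Set Λ.Path) : Prop :=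
  Λ.IsVertex v ∧ (∀ lam ∈ E, Λ.r lam = v ∧ lam ≠ v) ∧ E.Finite ∧ Λ.Exhaustive v E

/-- `FE(Λ)`: the finite exhaustive sets. -/
def FE : Set (Set Λ.Path) := {E | ∃ v, Λ.FEat v E}

/-- `λE = {λμ : μ ∈ E, r(μ) = s(λ)}`. -/
def lamSet (lam : Λ.Path) (E : Set Λ.Path) : Set Λ.Path :=
  {x | ∃ mu ∈ E, Λ.s lam = Λ.r mu ∧ Λ.comp lam mu = x}

/-- `EΛ = {λμ : λ ∈ E, r(μ) = s(λ)}`. -/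
def setLam (E : Set Λ.Path) : Set Λ.Path :=
  {x | ∃ lam ∈ E, ∃ mu, Λ.s lam = Λ.r mu ∧ Λ.comp lam mu = x}

/-- `𝓔 ⊆ FE(Λ)` is satiated if it satisfies (S1)--(S4). -/
def Satiated (𝓔 : Set (Set Λ.Path)) : Prop :=
  𝓔 ⊆ Λ.FE ∧
  (∀ G ∈ 𝓔, ∀ E ∈ Λ.FE, G ⊆ E → E ∈ 𝓔) ∧
  (∀ G ∈ 𝓔, ∀ v, Λ.FEat v G → ∀ mu, Λ.r mu = v → mu ∉ Λ.setLam G → Λ.Ext mu G ∈ 𝓔) ∧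
  (∀ G ∈ 𝓔, ∀ n : Λ.Path → Fin k → ℕ, (∀ lam ∈ G, 0 < n lam ∧ n lam ≤ Λ.d lam) →
    ((fun lam => Λ.seg lam 0 (n lam)) '' G) ∈ 𝓔) ∧
  (∀ G ∈ 𝓔, ∀ G' ⊆ G, ∀ Gl : Λ.Path → Set Λ.Path,
    (∀ lam ∈ G', Gl lam ∈ 𝓔 ∧ Λ.FEat (Λ.s lam) (Gl lam)) →
    ((G \ G') ∪ ⋃ lam ∈ G', Λ.lamSet lam (Gl lam)) ∈ 𝓔)

/-- The satiation `𝓔̄` of `𝓔`: the smallest satiated subset of `FE(Λ)` containing `𝓔`. -/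
def satiation (𝓔 : Set (Set Λ.Path)) : Set (Set Λ.Path) :=
  ⋂₀ {F | 𝓔 ⊆ F ∧ Λ.Satiated F}

/-- `ΠE`: the smallest subset of `Λ` containing `E` which is closed under the operation
`(λ,μ,σ) ↦ λ Ext(μ;{σ})` for `λ,μ,σ ∈ ΠE` with `d(λ) = d(μ)`, `s(λ) = s(μ)`. -/
def PiSet (E : Set Λ.Path) : Set Λ.Path :=
  ⋂₀ {G | E ⊆ G ∧ ∀ lam mu sig, lam ∈ G → mu ∈ G → sig ∈ G →
    Λ.d lam = Λ.d mu → Λ.s lam = Λ.s mu → Λ.lamSet lam (Λ.Ext mu {sig}) ⊆ G}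

/-- `Σ₁(𝓔)`: finite sets `F ⊆ r(E)Λ \ Λ⁰` containing some `E ∈ 𝓔`. -/
def Sig1 (𝓔 : Set (Set Λ.Path)) : Set (Set Λ.Path) :=
  {F | ∃ E ∈ 𝓔, ∃ v, Λ.FEat v E ∧ E ⊆ F ∧ F.Finite ∧
    ∀ lam ∈ F, Λ.r lam = v ∧ ¬ Λ.IsVertex lam}

/-- `Σ₂(𝓔) = {Ext(μ;E) : E ∈ 𝓔, μ ∈ r(E)Λ \ EΛ}`. -/
def Sig2 (𝓔 : Set (Set Λ.Path)) : Set (Set Λ.Path) :=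
  {F | ∃ E ∈ 𝓔, ∃ v, Λ.FEat v E ∧ ∃ mu, Λ.r mu = v ∧ mu ∉ Λ.setLam E ∧ F = Λ.Ext mu E}

/-- `Σ₃(𝓔) = {{λ(0,n_λ) : λ ∈ E} : E ∈ 𝓔, 0 < n_λ ≤ d(λ)}`. -/
def Sig3 (𝓔 : Set (Set Λ.Path)) : Set (Set Λ.Path) :=
  {F | ∃ E ∈ 𝓔, ∃ n : Λ.Path → Fin k → ℕ, (∀ lam ∈ E, 0 < n lam ∧ n lam ≤ Λ.d lam) ∧
    F = (fun lam => Λ.seg lam 0 (n lam)) '' E}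

/-- `Σ₄(𝓔) = {(E \ F) ∪ ⋃_{λ ∈ F} λ F_λ : E ∈ 𝓔, F ⊆ E, F_λ ∈ s(λ)𝓔}`. -/
def Sig4 (𝓔 : Set (Set Λ.Path)) : Set (Set Λ.Path) :=
  {G | ∃ E ∈ 𝓔, ∃ F ⊆ E, ∃ Fl : Λ.Path → Set Λ.Path,
    (∀ lam ∈ F, Fl lam ∈ 𝓔 ∧ Λ.FEat (Λ.s lam) (Fl lam)) ∧
    G = (E \ F) ∪ ⋃ lam ∈ F, Λ.lamSet lam (Fl lam)}

/-- `Σ = Σ₄ ∘ Σ₃ ∘ Σ₂ ∘ Σ₁`. -/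
def SigmaStep (𝓔 : Set (Set Λ.Path)) : Set (Set Λ.Path) :=
  Λ.Sig4 (Λ.Sig3 (Λ.Sig2 (Λ.Sig1 𝓔)))

/-- `Σ^∞(𝓔) = ⋃_{n ≥ 1} Σ^n(𝓔)`. -/
def SigmaInf (𝓔 : Set (Set Λ.Path)) : Set (Set Λ.Path) :=
  ⋃ n : ℕ, (Λ.SigmaStep)^[n + 1] 𝓔

section StarAlgebra

variable {A : Type*} [Ring A] [StarRing A]

/-- The product `∏_{λ ∈ E} (t_v - t_λ t_λ*)` (the factors pairwise commute for any
family satisfying (TCK1)--(TCK3), so the implicit choice of ordering is immaterial). -/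
noncomputable def gapProd (t : Λ.Path → A) (v : Λ.Path) (E : Set Λ.Path) : A :=
  listProd E fun lam => t v - t lam * star (t lam)

/-- Conditions (TCK1)--(TCK3) on a family `{t_λ}`. -/
def TCKFamily (t : Λ.Path → A) : Prop :=
  (∀ v, Λ.IsVertex v → star (t v) = t v ∧ t v * t v = t v) ∧
  (∀ v w, Λ.IsVertex v → Λ.IsVertex w → v ≠ w → t v * t w = 0) ∧
  (∀ lam mu, Λ.s lam = Λ.r mu → t lam * t mu = t (Λ.comp lam mu)) ∧
  (∀ lam mu, star (t lam) * t mu = ∑ᶠ p ∈ Λ.Lmin lam mu, t p.1 * star (t p.2))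

/-- A relative Cuntz-Krieger `(Λ;𝓔)`-family: (TCK1)--(TCK3) together with (CK). -/
def RCKFamily (𝓔 : Set (Set Λ.Path)) (t : Λ.Path → A) : Prop :=
  Λ.TCKFamily t ∧ ∀ E ∈ 𝓔, ∀ v, Λ.FEat v E → Λ.gapProd t v E = 0

/-- `Θ(t)^{ΠE}_{λ,μ} = t_λ (∏_{λν ∈ ΠE, d(ν) > 0} (t_{s(λ)} - t_ν t_ν*)) t_μ*`. -/
noncomputable def Theta (t : Λ.Path → A) (E : Set Λ.Path) (lam mu : Λ.Path) : A :=
  t lam *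
    listProd {nu | Λ.s lam = Λ.r nu ∧ ¬ Λ.IsVertex nu ∧ Λ.comp lam nu ∈ Λ.PiSet E}
      (fun nu => t (Λ.s lam) - t nu * star (t nu)) *
    star (t mu)

end StarAlgebra

end KGraph

/-- A graph morphism `x : Ω_{k,m} → Λ`, encoded by its length `m = d(x) ∈ (ℕ∪{∞})^k`
and its values `x(p,q)` on the morphisms `(p,q)` of `Ω_{k,m}` (with the junk value
`x(0,0)` outside the meaningful domain, so graph morphisms are extensional). -/
structure GMor {k : ℕ} (Λ : KGraph k) where
  len : Fin k → ℕ∞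
  seg : (Fin k → ℕ) → (Fin k → ℕ) → Λ.Path
  d_seg : ∀ p q, p ≤ q → (∀ i, (q i : ℕ∞) ≤ len i) → Λ.d (seg p q) = q - p
  r_seg : ∀ p q, p ≤ q → (∀ i, (q i : ℕ∞) ≤ len i) → Λ.r (seg p q) = seg p p
  s_seg : ∀ p q, p ≤ q → (∀ i, (q i : ℕ∞) ≤ len i) → Λ.s (seg p q) = seg q q
  comp_seg : ∀ p q u, p ≤ q → q ≤ u → (∀ i, (u i : ℕ∞) ≤ len i) →
    Λ.comp (seg p q) (seg q u) = seg p u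
  seg_junk : ∀ p q, ¬ (p ≤ q ∧ ∀ i, (q i : ℕ∞) ≤ len i) → seg p q = seg 0 0

namespace GMor

variable {k : ℕ} {Λ : KGraph k}

/-- The range `r(x) = x(0)` of a graph morphism. -/
def range (x : GMor Λ) : Λ.Path := x.seg 0 0

/-- `y = x|_n^{d(x)}`, the restriction of `x` (defined for `n ≤ d(x)`):
`d(y) = d(x) - n` and `y(p,q) = x(n+p, n+q)`. -/
def IsRestriction (y x : GMor Λ) (n : Fin k → ℕ) : Prop :=
  (∀ i, y.len i = x.len i - (n i : ℕ∞)) ∧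
  ∀ p q, p ≤ q → (∀ i, (q i : ℕ∞) ≤ y.len i) → y.seg p q = x.seg (n + p) (n + q)

/-- `y = λx`, the extension of `x` by `λ ∈ Λ r(x)`: `d(y) = d(λ) + d(x)`,
`y(0, d(λ)) = λ` and `y(d(λ), d(λ)+n) = x(0,n)` for `n ≤ d(x)`. -/
def IsExtension (y : GMor Λ) (lam : Λ.Path) (x : GMor Λ) : Prop :=
  (∀ i, y.len i = (Λ.d lam i : ℕ∞) + x.len i) ∧
  y.seg 0 (Λ.d lam) = lam ∧
  ∀ n : Fin k → ℕ, (∀ i, (n i : ℕ∞) ≤ x.len i) →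
    y.seg (Λ.d lam) (Λ.d lam + n) = x.seg 0 n

/-- `x ∈ FΛ^∞`: `x` has an initial segment belonging to `F`. -/
def HasInit (x : GMor Λ) (F : Set Λ.Path) : Prop :=
  ∃ lam ∈ F, (∀ i, (Λ.d lam i : ℕ∞) ≤ x.len i) ∧ x.seg 0 (Λ.d lam) = lam

/-- `z` restricts to `x` on `Ω_{k, d(x)}`. -/
def Agrees (z x : GMor Λ) : Prop :=
  ∀ p q, p ≤ q → (∀ i, (q i : ℕ∞) ≤ x.len i) → z.seg p q = x.seg p q

/-- `z ∈ MCE(x,y)` for graph morphisms `x, y`. -/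
def IsMCE (z x y : GMor Λ) : Prop :=
  (∀ i, z.len i = max (x.len i) (y.len i)) ∧ z.Agrees x ∧ z.Agrees y

/-- `x` is aperiodic: for distinct `λ, μ ∈ Λ r(x)`, `MCE(λx, μx) = ∅`. -/
def Aperiodic (x : GMor Λ) : Prop :=
  ∀ lam mu : Λ.Path, lam ≠ mu → Λ.s lam = x.range → Λ.s mu = x.range →
    ∀ lx mx : GMor Λ, lx.IsExtension lam x → mx.IsExtension mu x →
      ∀ z : GMor Λ, ¬ z.IsMCE lx mx

end GMor

namespace KGraph

variable {k : ℕ} (Λ : KGraph k)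

/-- `x ∈ ∂(Λ;𝓔)`: an `𝓔`-compatible boundary path. -/
def IsBdry (𝓔 : Set (Set Λ.Path)) (x : GMor Λ) : Prop :=
  ∀ n : Fin k → ℕ, (∀ i, (n i : ℕ∞) ≤ x.len i) →
    ∀ E ∈ 𝓔, Λ.FEat (x.seg n n) E →
      ∃ lam ∈ E, (∀ i, ((n + Λ.d lam) i : ℕ∞) ≤ x.len i) ∧ x.seg n (n + Λ.d lam) = lam

/-- Condition (C): aperiodic `𝓔`-compatible boundary paths out of every vertex, and
avoiding any given `F ∈ vFE(Λ) \ 𝓔`. -/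
def CondC (𝓔 : Set (Set Λ.Path)) : Prop :=
  (∀ v, Λ.IsVertex v → ∃ x : GMor Λ, Λ.IsBdry 𝓔 x ∧ x.range = v ∧ x.Aperiodic) ∧
  (∀ v F, Λ.FEat v F → F ∉ 𝓔 →
    ∃ x : GMor Λ, Λ.IsBdry 𝓔 x ∧ x.range = v ∧ ¬ x.HasInit F ∧ x.Aperiodic)

end KGraph

namespace KGraph

variable {k : ℕ} (Λ : KGraph k)

theorem split_comp {p q : Λ.Path} (h : Λ.s p = Λ.r q) :
    Λ.split (Λ.comp p q) (Λ.d p) = (p, q) := by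
  have hd : Λ.d (Λ.comp p q) = Λ.d p + Λ.d q := Λ.d_comp p q h
  have hle : Λ.d p ≤ Λ.d (Λ.comp p q) := by rw [hd]; exact le_self_add
  have hsub : Λ.d (Λ.comp p q) = Λ.d p + (Λ.d (Λ.comp p q) - Λ.d p) := by
    rw [hd, add_tsub_cancel_left]
  have hu := Λ.factor (Λ.comp p q) (Λ.d p) (Λ.d (Λ.comp p q) - Λ.d p) hsub
  rw [split, dif_pos hle]
  exact hu.unique hu.choose_spec.1
    ⟨h, rfl, by rw [hd, add_tsub_cancel_left], rfl⟩

theorem split_zero (lam : Λ.Path) : Λ.split lam 0 = (Λ.r lam, lam) := by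
  have := Λ.split_comp (Λ.s_r lam)
  rwa [Λ.range_comp, Λ.d_r] at this

theorem split_d (lam : Λ.Path) : Λ.split lam (Λ.d lam) = (lam, Λ.s lam) := by
  have := Λ.split_comp (Λ.r_s lam).symm
  rwa [Λ.comp_source] at this

theorem seg_zero_d (lam : Λ.Path) : Λ.seg lam 0 (Λ.d lam) = lam := by
  rw [seg, split_d, split_zero]

variable {Λ} in
theorem IsVertex.r_eq {v : Λ.Path} (hv : Λ.IsVertex v) : Λ.r v = v := by
  have h := Λ.split_d v
  rw [show Λ.d v = 0 from hv, split_zero] at h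
  exact congrArg Prod.fst h

variable {Λ} in
theorem Lmin_swap {mu nu a b : Λ.Path} (h : (a, b) ∈ Λ.Lmin mu nu) : (b, a) ∈ Λ.Lmin nu mu := by
  obtain ⟨h1, h2, h3, h4, h5, h6⟩ := h
  dsimp only at h1 h2 h3 h4 h5 h6
  refine ⟨h2, h1, h3.symm, ?_⟩
  change Λ.comp nu b ∈ Λ.MCE nu mu
  rw [← h3]
  exact ⟨by rw [h4, sup_comm], h6, h5⟩

theorem Lmin_self (lam : Λ.Path) : Λ.Lmin lam lam = {(Λ.s lam, Λ.s lam)} := by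
  have vertex_of_min : ∀ a, Λ.s lam = Λ.r a → Λ.d (Λ.comp lam a) = Λ.d lam → a = Λ.s lam := by
    intro a ha hd
    rw [Λ.d_comp _ _ ha] at hd
    have ha0 : Λ.IsVertex a := add_eq_left.mp hd
    rw [ha, ha0.r_eq]
  ext ⟨a, b⟩
  simp only [Set.mem_singleton_iff, Prod.mk.injEq]
  constructor
  · rintro ⟨h1, h2, h3, h4, -, -⟩
    dsimp only at h1 h2 h3 h4
    rw [sup_idem] at h4
    exact ⟨vertex_of_min a h1 h4, vertex_of_min b h2 (h3 ▸ h4)⟩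
  · rintro ⟨rfl, rfl⟩
    refine ⟨(Λ.r_s lam).symm, (Λ.r_s lam).symm, rfl, ?_⟩
    change Λ.comp lam (Λ.s lam) ∈ Λ.MCE lam lam
    rw [Λ.comp_source]
    exact ⟨(sup_idem _).symm, Λ.seg_zero_d lam, Λ.seg_zero_d lam⟩

variable {Λ} in
theorem Exhaustive.nonempty {v : Λ.Path} {E : Set Λ.Path} (hv : Λ.IsVertex v)
    (h : Λ.Exhaustive v E) : E.Nonempty := by
  obtain ⟨-, -, nu, hnu, -⟩ := h v hv.r_eq
  exact ⟨nu, hnu⟩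

/-- A finite exhaustive set determines its range vertex. -/
theorem FEat_of_mem_FE {v : Λ.Path} {E : Set Λ.Path} (hr : ∀ lam ∈ E, Λ.r lam = v)
    (hE : E ∈ Λ.FE) : Λ.FEat v E := by
  obtain ⟨w, hw⟩ := hE
  obtain ⟨nu, hnu⟩ := Exhaustive.nonempty hw.1 hw.2.2.2
  have hwv : w = v := (hw.2.1 nu hnu).1.symm.trans (hr nu hnu)
  exact hwv ▸ hw

section StarAlgebra

variable {A : Type*} [Ring A] [StarRing A] {Λ} {t : Λ.Path → A}

theorem TCKFamily.star_mul_self (ht : Λ.TCKFamily t) (lam : Λ.Path) :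
    star (t lam) * t lam = t (Λ.s lam) := by
  obtain ⟨hstar, hidem⟩ := ht.1 (Λ.s lam) (Λ.d_s lam)
  rw [ht.2.2.2, Lmin_self, finsum_mem_singleton, hstar, hidem]

theorem TCKFamily.ne_zero (ht : Λ.TCKFamily t) (hnz : ∀ v, Λ.IsVertex v → t v ≠ 0)
    (lam : Λ.Path) : t lam ≠ 0 := by
  intro h
  apply hnz (Λ.s lam) (Λ.d_s lam)
  rw [← ht.star_mul_self, h, mul_zero]

theorem TCKFamily.star_mul_eq_zero (ht : Λ.TCKFamily t) {lam nu : Λ.Path} {E : Set Λ.Path}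
    (hE : Λ.Ext lam E = ∅) (hnu : nu ∈ E) : star (t nu) * t lam = 0 := by
  have hempty : Λ.Lmin nu lam = ∅ := by
    rw [Set.eq_empty_iff_forall_notMem]
    rintro ⟨b, a⟩ h
    have ha : a ∈ Λ.Ext lam E := ⟨h.2.1.symm, nu, hnu, b, Lmin_swap h⟩
    simp [hE] at ha
  rw [ht.2.2.2, hempty, finsum_mem_empty]

/-- The gap projection of `E` dominates the range projection of any path having no common
extension with an element of `E`. -/
theorem TCKFamily.gapProd_mul (ht : Λ.TCKFamily t) {lam v : Λ.Path} {E : Set Λ.Path}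
    (hlam : Λ.r lam = v) (hE : Λ.Ext lam E = ∅) : Λ.gapProd t v E * t lam = t lam := by
  have hfactor : ∀ nu ∈ E, (t v - t nu * star (t nu)) * t lam = t lam := by
    intro nu hnu
    rw [sub_mul, mul_assoc, ht.star_mul_eq_zero hE hnu, mul_zero, sub_zero, ← hlam,
      ht.2.2.1 _ _ (Λ.s_r lam), Λ.range_comp]
  have hlist : ∀ l : List Λ.Path, (∀ nu ∈ l, nu ∈ E) →
      (l.map fun nu => t v - t nu * star (t nu)).prod * t lam = t lam := by
    intro l
    induction l with
    | nil => simp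
    | cons a l ih =>
      intro h
      rw [List.map_cons, List.prod_cons, mul_assoc, ih fun nu hnu => h nu (by simp [hnu]),
        hfactor a (h a (by simp))]
  unfold gapProd listProd
  split_ifs with hfin
  · exact hlist _ fun nu hnu => by simpa using hnu
  · exact one_mul _

end StarAlgebra

end KGraph

/-- Corollary 4.11: for a relative Cuntz-Krieger `(Λ;𝓔)`-family with
nonzero vertex projections and nonzero gap products for `F ∈ FE(Λ) \ 𝓔`, a gap
product over a finite `E ⊆ vΛ \ Λ⁰` vanishes iff `E ∈ 𝓔`. -/
theorem statement9 {k : ℕ} (Λ : KGraph k) (hΛ : Λ.FinitelyAligned)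
    (𝓔 : Set (Set Λ.Path)) (h𝓔 : Λ.Satiated 𝓔)
    {A : Type*} [NormedRing A] [StarRing A] [CStarRing A] [NormedAlgebra ℂ A]
    [CompleteSpace A] [StarModule ℂ A]
    (t : Λ.Path → A) (ht : Λ.RCKFamily 𝓔 t)
    (hnz : ∀ v, Λ.IsVertex v → t v ≠ 0)
    (hfe : ∀ F v, Λ.FEat v F → F ∉ 𝓔 → Λ.gapProd t v F ≠ 0)
    (v : Λ.Path) (hv : Λ.IsVertex v)
    (E : Set Λ.Path) (hEfin : E.Finite)
    (hEsub : ∀ lam ∈ E, Λ.r lam = v ∧ ¬ Λ.IsVertex lam) :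
    Λ.gapProd t v E = 0 ↔ E ∈ 𝓔 := by
  have hFE := Λ.FEat_of_mem_FE (v := v) (E := E) fun lam h => (hEsub lam h).1
  constructor
  · intro h0
    by_contra hE
    have hexh : ¬ Λ.Exhaustive v E := fun hexh => hfe E v
      ⟨hv, fun lam h => ⟨(hEsub lam h).1, fun heq => (hEsub lam h).2 (heq ▸ hv)⟩, hEfin, hexh⟩
      hE h0
    simp only [KGraph.Exhaustive, not_forall, Set.not_nonempty_iff_eq_empty] at hexh
    obtain ⟨lam, hlam, hext⟩ := hexh
    apply ht.1.ne_zero hnz lam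
    rw [← ht.1.gapProd_mul hlam hext, h0, zero_mul]
  · exact fun hE => ht.2 E hE v (hFE (h𝓔.1 hE))
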